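/- Let Φ ⊂ ℙ³ (over ℂ) be a finite set of at least 9 points, and suppose the linear system of quadric surfaces through Φ has zero-dimensional base locus and contains a quadric cone W (an irreducible quadric surface) passing through Φ. Then for general members D₁, D₂ of this linear system the intersection D₁ · D₂ · W has degree 8, and therefore Σ_{ω ∈ Φ} mult_ω(D₁)·mult_ω(D₂) ≤ 8 < 9 ≤ |Φ|, a contradiction; hence no such configuration exists. -/

import Mathlib

open MvPolynomial

noncomputable section

/-- Complex projective n-space. -/
abbrev Pt (n : ℕ) := Projectivization ℂ (Fin (n+1) → ℂ)

/-- A homogeneous form vanishes at a point of projective space. -/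
def VanishesAt {n : ℕ} (F : MvPolynomial (Fin (n+1)) ℂ) (p : Pt n) : Prop :=
  ∀ (v : Fin (n+1) → ℂ) (hv : v ≠ 0), p = Projectivization.mk ℂ v hv → eval v F = 0

/-- The common zero locus of a set of forms. -/
def ZeroLocus {n : ℕ} (S : Set (MvPolynomial (Fin (n+1)) ℂ)) : Set (Pt n) :=
  {p | ∀ F ∈ S, VanishesAt F p}

/-- The vanishing of the resultant of two quadratics, the first of which has roots `α`, `β`. -/
theorem quadratic_root_of_resultant_eq_zero {a₁ b₁ c₁ a₂ b₂ c₂ α β : ℂ} (ha : a₁ ≠ 0)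
    (hb : b₁ = -a₁ * (α + β)) (hc : c₁ = a₁ * (α * β))
    (h : (a₁ * c₂ - a₂ * c₁) ^ 2 - (a₁ * b₂ - a₂ * b₁) * (b₁ * c₂ - b₂ * c₁) = 0) :
    a₂ * α ^ 2 + b₂ * α + c₂ = 0 ∨ a₂ * β ^ 2 + b₂ * β + c₂ = 0 := by
  have : a₁ ^ 2 * ((a₂ * α ^ 2 + b₂ * α + c₂) * (a₂ * β ^ 2 + b₂ * β + c₂)) = 0 := by
    subst hb hc
    linear_combination h
  simpa [ha] using this

theorem exists_roots_of_quadratic {a : ℂ} (ha : a ≠ 0) (b c : ℂ) :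
    ∃ α β, b = -a * (α + β) ∧ c = a * (α * β) := by
  obtain ⟨r, hr⟩ := IsAlgClosed.exists_pow_nat_eq (b ^ 2 - 4 * a * c) (n := 2) (by norm_num)
  refine ⟨(-b + r) / (2 * a), (-b - r) / (2 * a), by field_simp; ring, ?_⟩
  field_simp
  linear_combination hr

/-- The resultant of two quadratics in `w` over `ℂ[X]`, which has degree at most 8, vanishes if
they have at least 9 common zeros, counted over each value of `X` at most twice. -/
theorem resultant_eq_zero_of_card {a₁ a₂ : ℂ} {b₁ c₁ b₂ c₂ : Polynomial ℂ} (T : Finset (ℂ × ℂ))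
    (hT : 9 ≤ T.card) (hb₁ : b₁.natDegree ≤ 2) (hc₁ : c₁.natDegree ≤ 4)
    (hb₂ : b₂.natDegree ≤ 2) (hc₂ : c₂.natDegree ≤ 4)
    (hfib : ∀ s, (T.filter fun p => p.1 = s).card ≤ 2)
    (h₁ : ∀ p ∈ T, a₁ * p.2 ^ 2 + b₁.eval p.1 * p.2 + c₁.eval p.1 = 0)
    (h₂ : ∀ p ∈ T, a₂ * p.2 ^ 2 + b₂.eval p.1 * p.2 + c₂.eval p.1 = 0) :
    (Polynomial.C a₁ * c₂ - Polynomial.C a₂ * c₁) ^ 2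
      - (Polynomial.C a₁ * b₂ - Polynomial.C a₂ * b₁) * (b₁ * c₂ - b₂ * c₁) = 0 := by
  set D := Polynomial.C a₁ * c₂ - Polynomial.C a₂ * c₁ with hD
  set E := Polynomial.C a₁ * b₂ - Polynomial.C a₂ * b₁ with hE
  set G := b₁ * c₂ - b₂ * c₁ with hG
  have hEw : ∀ p ∈ T, E.eval p.1 * p.2 + D.eval p.1 = 0 := fun p hp => by
    simp only [hE, hD, Polynomial.eval_sub, Polynomial.eval_mul, Polynomial.eval_C]
    linear_combination a₁ * h₂ p hp - a₂ * h₁ p hp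
  have hGw : ∀ p ∈ T, G.eval p.1 = E.eval p.1 * p.2 ^ 2 := fun p hp => by
    simp only [hE, hG, Polynomial.eval_sub, Polynomial.eval_mul, Polynomial.eval_C]
    linear_combination b₁.eval p.1 * h₂ p hp - b₂.eval p.1 * h₁ p hp
  have hdvd : ∀ s ∈ T.image Prod.fst,
      (Polynomial.X - Polynomial.C s) ^ (T.filter fun p => p.1 = s).card ∣ D ^ 2 - E * G := by
    intro s hs
    obtain ⟨p, hp, rfl⟩ := Finset.mem_image.1 hs
    rcases (hfib p.1).lt_or_eq with hlt | heq
    · refine (pow_dvd_pow _ (Nat.lt_succ_iff.1 hlt)).trans ?_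
      rw [pow_one, Polynomial.dvd_iff_isRoot, Polynomial.IsRoot.def]
      simp only [Polynomial.eval_sub, Polynomial.eval_mul, Polynomial.eval_pow]
      rw [hGw p hp]
      linear_combination (D.eval p.1 - E.eval p.1 * p.2) * hEw p hp
    · obtain ⟨x, y, hxy, hset⟩ := Finset.card_eq_two.1 heq
      have hx : x ∈ T ∧ x.1 = p.1 := by
        simpa using (hset ▸ Finset.mem_insert_self x {y} : x ∈ T.filter fun q => q.1 = p.1)
      have hy : y ∈ T ∧ y.1 = p.1 := by
        simpa using (hset ▸ by simp : y ∈ T.filter fun q : ℂ × ℂ => q.1 = p.1)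
      have hne : x.2 - y.2 ≠ 0 := fun h =>
        hxy (Prod.ext (hx.2.trans hy.2.symm) (sub_eq_zero.1 h))
      have e1 := hEw x hx.1
      have e2 := hEw y hy.1
      have e3 := hGw x hx.1
      rw [hx.2] at e1 e3
      rw [hy.2] at e2
      have hE0 : E.eval p.1 = 0 := by
        refine (mul_eq_zero.1 (?_ : E.eval p.1 * (x.2 - y.2) = 0)).resolve_right hne
        linear_combination e1 - e2
      have hD0 : D.eval p.1 = 0 := by simpa [hE0] using e1
      have hG0 : G.eval p.1 = 0 := by simpa [hE0] using e3
      rw [heq, sq, sq]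
      exact dvd_sub (mul_dvd_mul (Polynomial.dvd_iff_isRoot.2 hD0) (Polynomial.dvd_iff_isRoot.2 hD0))
        (mul_dvd_mul (Polynomial.dvd_iff_isRoot.2 hE0) (Polynomial.dvd_iff_isRoot.2 hG0))
  have hprod : ∏ s ∈ T.image Prod.fst,
      (Polynomial.X - Polynomial.C s) ^ (T.filter fun p => p.1 = s).card ∣ D ^ 2 - E * G := by
    refine Finset.prod_dvd_of_coprime ?_ hdvd
    intro s _ t _ hst
    exact (Polynomial.isCoprime_X_sub_C_of_isUnit_sub
      (sub_ne_zero.2 hst).isUnit).pow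
  refine Polynomial.eq_zero_of_dvd_of_natDegree_lt hprod ?_
  have hdeg : (∏ s ∈ T.image Prod.fst,
      (Polynomial.X - Polynomial.C s) ^ (T.filter fun p : ℂ × ℂ => p.1 = s).card).natDegree = T.card := by
    rw [Polynomial.natDegree_prod_of_monic _ _ fun s _ => (Polynomial.monic_X_sub_C s).pow _]
    simp only [Polynomial.natDegree_pow, Polynomial.natDegree_X_sub_C, mul_one]
    exact (Finset.card_eq_sum_card_image Prod.fst T).symm
  have hD4 : D.natDegree ≤ 4 := Polynomial.natDegree_sub_le_of_le
    ((Polynomial.natDegree_C_mul_le _ _).trans hc₂) ((Polynomial.natDegree_C_mul_le _ _).trans hc₁)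
  have hE2 : E.natDegree ≤ 2 := Polynomial.natDegree_sub_le_of_le
    ((Polynomial.natDegree_C_mul_le _ _).trans hb₂) ((Polynomial.natDegree_C_mul_le _ _).trans hb₁)
  have hG6 : G.natDegree ≤ 6 := Polynomial.natDegree_sub_le_of_le
    (Polynomial.natDegree_mul_le_of_le hb₁ hc₂) (Polynomial.natDegree_mul_le_of_le hb₂ hc₁)
  have hR : (D ^ 2 - E * G).natDegree ≤ 8 := Polynomial.natDegree_sub_le_of_le
    (Polynomial.natDegree_pow_le_of_le 2 hD4) (Polynomial.natDegree_mul_le_of_le hE2 hG6)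
  omega

/-- A polynomial with more roots than its degree bound, the roots being the first coordinates of
a finite set of points of the plane lying over distinct first coordinates. -/
theorem eq_zero_of_injOn_fst {f : Polynomial ℂ} {T : Finset (ℂ × ℂ)}
    (hinj : Set.InjOn Prod.fst (T : Set (ℂ × ℂ))) (hdeg : f.natDegree < T.card)
    (h : ∀ p ∈ T, f.eval p.1 = 0) : f = 0 := by
  refine Polynomial.eq_zero_of_natDegree_lt_card_of_eval_eq_zero' f (T.image Prod.fst) ?_ ?_
  · simpa using h
  · rwa [Finset.card_image_of_injOn hinj]

/-- An additively closed family of quadratics `a w² + b(s) w + c(s)` with `deg b ≤ 2`,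
`deg c ≤ 4` that vanishes at sufficiently many points has infinitely many common zeros. -/
theorem infinite_common_zeros (V : Set (ℂ × Polynomial ℂ × Polynomial ℂ))
    (hadd : ∀ f ∈ V, ∀ g ∈ V, f + g ∈ V)
    (hb : ∀ f ∈ V, f.2.1.natDegree ≤ 2) (hc : ∀ f ∈ V, f.2.2.natDegree ≤ 4)
    (T : Finset (ℂ × ℂ)) (hT8 : 8 ≤ T.card) (hT9 : (∃ f ∈ V, f.1 ≠ 0) → 9 ≤ T.card)
    (hT : ∀ f ∈ V, ∀ p ∈ T, f.1 * p.2 ^ 2 + f.2.1.eval p.1 * p.2 + f.2.2.eval p.1 = 0) :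
    {p : ℂ × ℂ | ∀ f ∈ V, f.1 * p.2 ^ 2 + f.2.1.eval p.1 * p.2 + f.2.2.eval p.1 = 0}.Infinite := by
  set Z := {p : ℂ × ℂ | ∀ f ∈ V, f.1 * p.2 ^ 2 + f.2.1.eval p.1 * p.2 + f.2.2.eval p.1 = 0} with hZ
  have of_cofinite : ∀ B : Set ℂ, B.Finite → (∀ s ∉ B, ∃ w, (s, w) ∈ Z) → Z.Infinite := by
    intro B hB h hfin
    refine hB.infinite_compl ((hfin.image Prod.fst).subset fun s hs => ?_)
    obtain ⟨w, hw⟩ := h s hs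
    exact ⟨_, hw, rfl⟩
  by_cases hA : ∃ f ∈ V, f.1 ≠ 0
  · obtain ⟨f, hf, hf0⟩ := hA
    have hfib : ∀ s, (T.filter fun p => p.1 = s).card ≤ 2 := by
      intro s
      by_contra! hlt
      obtain ⟨x, y, z, hx, hy, hz, hxy, hxz, hyz⟩ := Finset.two_lt_card_iff.1 hlt
      obtain ⟨x1, x2⟩ := x
      obtain ⟨y1, y2⟩ := y
      obtain ⟨z1, z2⟩ := z
      simp only [Finset.mem_filter] at hx hy hz
      obtain ⟨hx, rfl⟩ := hx
      obtain ⟨hy, rfl⟩ := hy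
      obtain ⟨hz, rfl⟩ := hz
      simp only [ne_eq, Prod.mk.injEq, true_and] at hxy hxz hyz
      have e1 := hT f hf _ hx
      have e2 := hT f hf _ hy
      have e3 := hT f hf _ hz
      have : f.1 * ((x2 - y2) * (x2 - z2) * (y2 - z2)) = 0 := by
        linear_combination (y2 - z2) * e1 - (x2 - z2) * e2 + (x2 - y2) * e3
      simp [hf0, sub_eq_zero, hxy, hxz, hyz] at this
    refine of_cofinite ∅ Set.finite_empty fun s _ => ?_
    obtain ⟨α, β, hα, hβ⟩ := exists_roots_of_quadratic hf0 (f.2.1.eval s) (f.2.2.eval s)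
    have key : ∀ g ∈ V, g.1 * α ^ 2 + g.2.1.eval s * α + g.2.2.eval s = 0 ∨
        g.1 * β ^ 2 + g.2.1.eval s * β + g.2.2.eval s = 0 := by
      intro g hg
      refine quadratic_root_of_resultant_eq_zero hf0 hα hβ ?_
      have := congrArg (Polynomial.eval s) (resultant_eq_zero_of_card T (hT9 ⟨f, hf, hf0⟩) (hb f hf)
        (hc f hf) (hb g hg) (hc g hg) hfib (hT f hf) (hT g hg))
      simpa using this
    by_contra! hno
    have hα' := hno α
    have hβ' := hno β
    simp only [hZ, Set.mem_ofPred_eq, not_forall] at hα' hβ'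
    obtain ⟨g, hg, hgα⟩ := hα'
    obtain ⟨h, hh, hhβ⟩ := hβ'
    have hgβ := (key g hg).resolve_left hgα
    have hhα := (key h hh).resolve_right hhβ
    rcases key _ (hadd g hg h hh) with e | e <;>
      simp only [Prod.fst_add, Prod.snd_add, Polynomial.eval_add] at e
    · exact hgα (by linear_combination e - hhα)
    · exact hhβ (by linear_combination e - hgβ)
  · push Not at hA
    by_cases hinj : Set.InjOn Prod.fst (T : Set (ℂ × ℂ))
    · by_cases hB : ∃ f ∈ V, f.2.1 ≠ 0
      · obtain ⟨f, hf, hf0⟩ := hB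
        refine of_cofinite {s | f.2.1.IsRoot s} (Polynomial.finite_setOfPred_isRoot hf0) fun s hs => ?_
        refine ⟨-(f.2.2.eval s) / f.2.1.eval s, fun g hg => ?_⟩
        have h0 : f.2.1 * g.2.2 - g.2.1 * f.2.2 = 0 := by
          refine eq_zero_of_injOn_fst hinj (lt_of_le_of_lt (Polynomial.natDegree_sub_le_of_le
            (Polynomial.natDegree_mul_le_of_le (hb f hf) (hc g hg))
            (Polynomial.natDegree_mul_le_of_le (hb g hg) (hc f hf))) (by omega)) fun p hp => ?_
          have e1 := hT f hf p hp
          have e2 := hT g hg p hp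
          rw [hA f hf] at e1
          rw [hA g hg] at e2
          simp only [Polynomial.eval_sub, Polynomial.eval_mul]
          linear_combination f.2.1.eval p.1 * e2 - g.2.1.eval p.1 * e1
        have h1 := congrArg (Polynomial.eval s) h0
        simp only [Polynomial.eval_sub, Polynomial.eval_mul, Polynomial.eval_zero] at h1
        have hs' : f.2.1.eval s ≠ 0 := hs
        simp only [hA g hg]
        rw [zero_mul, zero_add, mul_div_assoc', div_add' _ _ _ hs', div_eq_zero_iff]
        left
        linear_combination h1
      · push Not at hB
        refine of_cofinite ∅ Set.finite_empty fun s _ => ⟨0, fun g hg => ?_⟩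
        have : g.2.2 = 0 := eq_zero_of_injOn_fst hinj ((hc g hg).trans_lt (by omega)) fun p hp => by
          simpa [hA g hg, hB g hg] using hT g hg p hp
        simp [this, hA g hg]
    · simp only [Set.InjOn, not_forall] at hinj
      obtain ⟨⟨s, x⟩, hx, ⟨t, y⟩, hy, hst, hne⟩ := hinj
      obtain rfl : s = t := hst
      have hxy : x - y ≠ 0 := fun h => hne (by rw [sub_eq_zero.1 h])
      refine (Set.infinite_range_of_injective (Prod.mk_right_injective s)).mono ?_
      rintro _ ⟨w, rfl⟩ f hf
      have e1 := hT f hf _ hx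
      have e2 := hT f hf _ hy
      simp only [hA f hf] at e1 e2 ⊢
      have hb0 : f.2.1.eval s = 0 := by
        refine (mul_eq_zero.1 (?_ : f.2.1.eval s * (x - y) = 0)).resolve_right hxy
        linear_combination e1 - e2
      rw [hb0] at e1 ⊢
      linear_combination e1

theorem exists_matrix_of_isHomogeneous_two {n : ℕ} {F : MvPolynomial (Fin n) ℂ}
    (hF : F.IsHomogeneous 2) :
    ∃ M : Matrix (Fin n) (Fin n) ℂ, F = ∑ i, ∑ j, C (M i j) * X i * X j := by
  rw [F.as_sum]
  refine Finset.sum_induction _ (fun G => ∃ M : Matrix (Fin n) (Fin n) ℂ,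
    G = ∑ i, ∑ j, C (M i j) * X i * X j) ?_ ⟨0, by simp⟩ fun d hd => ?_
  · rintro _ _ ⟨M, rfl⟩ ⟨N, rfl⟩
    exact ⟨M + N, by simp [add_mul, Finset.sum_add_distrib]⟩
  · have hdeg : d.degree = 2 := by
      have := hF (mem_support_iff.1 hd)
      rwa [Finsupp.degree_eq_weight_one]
    have hcard : Multiset.card (Finsupp.toMultiset d) = 2 := by
      rw [Finsupp.card_toMultiset]
      exact hdeg
    obtain ⟨i, j, hij⟩ := Multiset.card_eq_two.1 hcard
    have hd' : d = Finsupp.single i 1 + Finsupp.single j 1 := by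
      rw [← Finsupp.toMultiset_toFinsupp d, hij, Multiset.insert_eq_cons,
        ← Multiset.singleton_add, map_add, Multiset.toFinsupp_singleton,
        Multiset.toFinsupp_singleton]
    refine ⟨Matrix.single i j (coeff d F), ?_⟩
    rw [Finset.sum_eq_single i, Finset.sum_eq_single j]
    · rw [hd', Matrix.single_apply_same, C_mul_X_eq_monomial, X, monomial_mul, mul_one]
    · intro k _ hk
      simp [Matrix.single_apply_of_ne _ _ _ _ _ (fun h => hk h.2.symm)]
    · simp
    · intro k _ hk
      refine Finset.sum_eq_zero fun l _ => ?_
      simp [Matrix.single_apply_of_ne _ _ _ _ _ (fun h => hk h.1.symm)]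
    · simp

theorem eval_sum_matrix {n : ℕ} (M : Matrix (Fin n) (Fin n) ℂ) (v : Fin n → ℂ) :
    eval v (∑ i, ∑ j, C (M i j) * X i * X j) = v ⬝ᵥ M.mulVec v := by
  simp only [map_sum, map_mul, eval_C, eval_X, dotProduct, Matrix.mulVec, Finset.mul_sum]
  exact Finset.sum_congr rfl fun i _ => Finset.sum_congr rfl fun j _ => by ring

theorem eval_smul_of_isHomogeneous_two {n : ℕ} {F : MvPolynomial (Fin n) ℂ}
    (hF : F.IsHomogeneous 2) (c : ℂ) (v : Fin n → ℂ) :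
    eval (c • v) F = c ^ 2 * eval v F := by
  obtain ⟨M, rfl⟩ := exists_matrix_of_isHomogeneous_two hF
  simp only [eval_sum_matrix, Matrix.mulVec_smul, dotProduct_smul, smul_dotProduct, smul_eq_mul]
  ring

/-- A singular point of a quadric lies in the radical of the quadratic form. -/
theorem eval_add_of_pderiv_eq_zero {n : ℕ} {F : MvPolynomial (Fin n) ℂ}
    (hF : F.IsHomogeneous 2) {v : Fin n → ℂ} (hv : ∀ i, eval v (pderiv i F) = 0)
    (y : Fin n → ℂ) : eval (v + y) F = eval v F + eval y F := by
  obtain ⟨M, rfl⟩ := exists_matrix_of_isHomogeneous_two hF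
  have key : ∀ k, M.mulVec v k + Matrix.vecMul v M k = 0 := fun k => by
    rw [← hv k]
    simp [pderiv_X, Pi.single_apply, Finset.sum_add_distrib, Matrix.mulVec, Matrix.vecMul,
      dotProduct, mul_comm]
  have h : y ⬝ᵥ (M.mulVec v) + v ⬝ᵥ (M.mulVec y) = 0 := by
    rw [Matrix.dotProduct_mulVec v, dotProduct_comm _ y, ← dotProduct_add,
      show M.mulVec v + Matrix.vecMul v M = 0 from funext key, dotProduct_zero]
  simp only [eval_sum_matrix, Matrix.mulVec_add, dotProduct_add, add_dotProduct]
  linear_combination h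

theorem exists_diagonalization {F : MvPolynomial (Fin 4) ℂ} (hF : F.IsHomogeneous 2) :
    ∃ (w : Fin 4 → ℂ) (L : (Fin 4 → ℂ) ≃ₗ[ℂ] (Fin 4 → ℂ)),
      ∀ u, eval (L u) F = ∑ i, w i * u i ^ 2 := by
  obtain ⟨M, rfl⟩ := exists_matrix_of_isHomogeneous_two hF
  have h := QuadraticForm.equivalent_weightedSumSquares M.toQuadraticForm'
  rw [Module.finrank_fin_fun] at h
  obtain ⟨w, ⟨e⟩⟩ := h
  refine ⟨w, e.symm.toLinearEquiv, fun u => ?_⟩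
  have h1 := e.symm.map_app u
  rw [QuadraticMap.weightedSumSquares_apply] at h1
  rw [eval_sum_matrix]
  refine Eq.trans ?_ (h1.trans (Finset.sum_congr rfl fun i _ => by rw [smul_eq_mul, sq]))
  simp [Matrix.toQuadraticForm', Matrix.toLinearMap₂'_apply']
  rfl

/-- A combination of two squares of linear forms is reducible. -/
theorem not_irreducible_of_two_squares {n : ℕ} {F : MvPolynomial (Fin n) ℂ} (a b : ℂ)
    (l m : (Fin n → ℂ) →ₗ[ℂ] ℂ) (h : ∀ v, eval v F = a * l v ^ 2 + b * m v ^ 2) :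
    ¬ Irreducible F := by
  intro hirr
  obtain ⟨α, hα⟩ := IsAlgClosed.exists_pow_nat_eq a (n := 2) (by norm_num)
  obtain ⟨β, hβ⟩ := IsAlgClosed.exists_pow_nat_eq (-b) (n := 2) (by norm_num)
  have hform : ∀ k : (Fin n → ℂ) →ₗ[ℂ] ℂ, ∃ p : MvPolynomial (Fin n) ℂ, ∀ v, eval v p = k v := by
    intro k
    refine ⟨∑ i, C (k (Pi.single i 1)) * X i, fun v => ?_⟩
    rw [k.pi_apply_eq_sum_univ v]
    simp only [map_sum, map_mul, eval_C, eval_X, smul_eq_mul]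
    refine Finset.sum_congr rfl fun i _ => ?_
    rw [mul_comm]
    congr 2
    ext j
    simp [Pi.single_apply, eq_comm]
  have hunit : ∀ (k : (Fin n → ℂ) →ₗ[ℂ] ℂ) (p : MvPolynomial (Fin n) ℂ),
      (∀ v, eval v p = k v) → ¬ IsUnit p := by
    intro k p hp hu
    have := hu.map (eval (0 : Fin n → ℂ))
    rw [hp, map_zero] at this
    exact not_isUnit_zero this
  obtain ⟨p, hp⟩ := hform (α • l + β • m)
  obtain ⟨q, hq⟩ := hform (α • l - β • m)
  have hpq : F = p * q := by
    refine MvPolynomial.funext fun v => ?_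
    rw [h, map_mul, hp, hq]
    simp only [LinearMap.add_apply, LinearMap.sub_apply, LinearMap.smul_apply, smul_eq_mul]
    linear_combination -(l v ^ 2) * hα + m v ^ 2 * hβ
  rcases hirr.isUnit_or_isUnit hpq with hu | hu
  · exact hunit _ p hp hu
  · exact hunit _ q hq hu

/-- The linear change of coordinates `(u₀, u₁, u₂, u₃) ↦ (x, y, z, t)` with
`u₀ u₂ - u₁² = (α x)² - (γ z)² - (β y)²`. -/
def conicCoordinates (α β γ : ℂ) (hα : α ≠ 0) (hβ : β ≠ 0) (hγ : γ ≠ 0) :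
    (Fin 4 → ℂ) ≃ₗ[ℂ] (Fin 4 → ℂ) where
  toFun u := ![(u 0 + u 2) / (2 * α), u 1 / β, (u 0 - u 2) / (2 * γ), u 3]
  invFun x := ![α * x 0 + γ * x 2, β * x 1, α * x 0 - γ * x 2, x 3]
  map_add' u v := by
    ext i
    fin_cases i <;> simp <;> ring
  map_smul' c u := by
    ext i
    fin_cases i <;> simp <;> ring
  left_inv u := by
    ext i
    fin_cases i <;> simp <;> field_simp <;> ring
  right_inv u := by
    ext i
    fin_cases i <;> simp <;> field_simp <;> ring

theorem exists_cone_normal_form {F : MvPolynomial (Fin 4) ℂ} (hF : F.IsHomogeneous 2)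
    (hirr : Irreducible F) {v : Fin 4 → ℂ} (hv : v ≠ 0)
    (hsing : ∀ i, eval v (pderiv i F) = 0) :
    ∃ L : (Fin 4 → ℂ) ≃ₗ[ℂ] (Fin 4 → ℂ), ∀ u, eval (L u) F = u 0 * u 2 - u 1 ^ 2 := by
  obtain ⟨w, L, hL, hw3⟩ : ∃ (w : Fin 4 → ℂ) (L : (Fin 4 → ℂ) ≃ₗ[ℂ] (Fin 4 → ℂ)),
      (∀ u, eval (L u) F = ∑ i, w i * u i ^ 2) ∧ w 3 = 0 := by
    obtain ⟨w, L, hL⟩ := exists_diagonalization hF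
    obtain ⟨i, hi⟩ : ∃ i, L.symm v i ≠ 0 := by
      by_contra! h
      exact hv (L.symm.map_eq_zero_iff.1 (funext h))
    have hwi : w i = 0 := by
      have h := eval_add_of_pderiv_eq_zero hF hsing (L (Pi.single i 1))
      have hadd : v + L (Pi.single i 1) = L (L.symm v + Pi.single i 1) := by simp
      rw [hadd, ← L.apply_symm_apply v, L.symm_apply_apply, hL, hL, hL,
        ← Finset.sum_add_distrib, ← sub_eq_zero, ← Finset.sum_sub_distrib,
        Finset.sum_eq_single i] at h
      · simp only [Pi.add_apply, Pi.single_eq_same] at h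
        have : w i * (2 * L.symm v i) = 0 := by linear_combination h
        simpa [hi] using this
      · intro j _ hj
        simp [Pi.single_eq_of_ne hj]
      · simp
    refine ⟨w ∘ Equiv.swap i 3, (LinearEquiv.funCongrLeft ℂ ℂ (Equiv.swap i 3)).trans L,
      fun u => ?_, by simp [hwi]⟩
    rw [LinearEquiv.trans_apply, hL, ← Equiv.sum_comp (Equiv.swap i 3)]
    simp [LinearEquiv.funCongrLeft_apply, LinearMap.funLeft_apply]
  have hL' : ∀ x, eval x F = w 0 * L.symm x 0 ^ 2 + w 1 * L.symm x 1 ^ 2 + w 2 * L.symm x 2 ^ 2 :=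
    fun x => by
      have := hL (L.symm x)
      simpa [Fin.sum_univ_four, hw3] using this
  let l (i : Fin 4) : (Fin 4 → ℂ) →ₗ[ℂ] ℂ := LinearMap.proj i ∘ₗ L.symm.toLinearMap
  have h0 : w 0 ≠ 0 := fun h => not_irreducible_of_two_squares (w 1) (w 2) (l 1) (l 2)
    (fun x => by simp [hL', h, l]) hirr
  have h1 : w 1 ≠ 0 := fun h => not_irreducible_of_two_squares (w 0) (w 2) (l 0) (l 2)
    (fun x => by simp [hL', h, l]) hirr
  have h2 : w 2 ≠ 0 := fun h => not_irreducible_of_two_squares (w 0) (w 1) (l 0) (l 1)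
    (fun x => by simp [hL', h, l]) hirr
  obtain ⟨α, hα⟩ := IsAlgClosed.exists_pow_nat_eq (w 0) (n := 2) (by norm_num)
  obtain ⟨β, hβ⟩ := IsAlgClosed.exists_pow_nat_eq (-w 1) (n := 2) (by norm_num)
  obtain ⟨γ, hγ⟩ := IsAlgClosed.exists_pow_nat_eq (-w 2) (n := 2) (by norm_num)
  have hα0 : α ≠ 0 := by rintro rfl; simp [h0.symm] at hα
  have hβ0 : β ≠ 0 := by rintro rfl; simp [h1] at hβ
  have hγ0 : γ ≠ 0 := by rintro rfl; simp [h2] at hγ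
  refine ⟨(conicCoordinates α β γ hα0 hβ0 hγ0).trans L, fun u => ?_⟩
  rw [LinearEquiv.trans_apply, hL']
  simp only [LinearEquiv.symm_apply_apply, conicCoordinates, LinearEquiv.coe_mk, LinearMap.coe_mk,
    AddHom.coe_mk, Matrix.cons_val]
  rw [← hα, ← neg_eq_iff_eq_neg.2 hβ, ← neg_eq_iff_eq_neg.2 hγ]
  field_simp
  ring

/-- The linear automorphism of the cone `u₀ u₂ = u₁²` induced by `(s : t) ↦ (s : t - c s)`. -/
def coneShear (c : ℂ) : (Fin 4 → ℂ) ≃ₗ[ℂ] (Fin 4 → ℂ) where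
  toFun u := ![u 0, u 1 - c * u 0, u 2 - 2 * c * u 1 + c ^ 2 * u 0, u 3]
  invFun u := ![u 0, u 1 + c * u 0, u 2 + 2 * c * u 1 + c ^ 2 * u 0, u 3]
  map_add' u v := by
    ext i
    fin_cases i <;> simp <;> ring
  map_smul' a u := by
    ext i
    fin_cases i <;> simp <;> ring
  left_inv u := by
    ext i
    fin_cases i <;> simp
    ring
  right_inv u := by
    ext i
    fin_cases i <;> simp
    ring

theorem exists_coneShear_symm_ne_zero (S : Finset (Fin 4 → ℂ)) :
    ∃ c, ∀ u ∈ S, (coneShear c).symm u 2 = 0 → u 0 = 0 ∧ u 1 = 0 ∧ u 2 = 0 := by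
  let p (u : Fin 4 → ℂ) : Polynomial ℂ :=
    .C (u 0) * .X ^ 2 + .C (2 * u 1) * .X + .C (u 2)
  have hfin : (⋃ u ∈ S.filter (p · ≠ 0), {c | (p u).IsRoot c}).Finite :=
    (S.filter (p · ≠ 0)).finite_toSet.biUnion fun u hu =>
      Polynomial.finite_setOfPred_isRoot (Finset.mem_filter.1 hu).2
  obtain ⟨c, hc⟩ := hfin.exists_notMem
  refine ⟨c, fun u hu h => ?_⟩
  by_cases hp : p u = 0
  · have h0 := congrArg (Polynomial.coeff · 0) hp
    have h1 := congrArg (Polynomial.coeff · 1) hp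
    have h2 := congrArg (Polynomial.coeff · 2) hp
    simp [p, Polynomial.coeff_X, Polynomial.coeff_C] at h0 h1 h2
    exact ⟨h2, h1, h0⟩
  · refine absurd ?_ hc
    simp only [Set.mem_iUnion]
    refine ⟨u, Finset.mem_filter.2 ⟨hu, hp⟩, ?_⟩
    have h' : u 2 + 2 * c * u 1 + c ^ 2 * u 0 = 0 := h
    change (p u).eval c = 0
    simp only [p, Polynomial.eval_add, Polynomial.eval_mul, Polynomial.eval_C, Polynomial.eval_pow,
      Polynomial.eval_X]
    linear_combination h'

/-- The restriction of a quadric to the cone `u₀ u₂ = u₁²`, parametrized by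
`(s, w) ↦ (s² : s : 1 : w)`. -/
theorem exists_restriction_to_cone {F : MvPolynomial (Fin 4) ℂ} (hF : F.IsHomogeneous 2)
    (L : (Fin 4 → ℂ) ≃ₗ[ℂ] (Fin 4 → ℂ)) :
    ∃ f : ℂ × Polynomial ℂ × Polynomial ℂ, f.2.1.natDegree ≤ 2 ∧ f.2.2.natDegree ≤ 4 ∧
      eval (L ![0, 0, 0, 1]) F = f.1 ∧ ∀ s w, eval (L ![s ^ 2, s, 1, w]) F =
        f.1 * w ^ 2 + f.2.1.eval s * w + f.2.2.eval s := by
  obtain ⟨M, rfl⟩ := exists_matrix_of_isHomogeneous_two hF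
  obtain ⟨N, hN⟩ : ∃ N : Matrix (Fin 4) (Fin 4) ℂ, ∀ u,
      eval (L u) (∑ i, ∑ j, C (M i j) * X i * X j) = u ⬝ᵥ N.mulVec u := by
    let A := LinearMap.toMatrix' L.toLinearMap
    refine ⟨A.transpose * M * A, fun u => ?_⟩
    have hA : L u = A.mulVec u := (LinearMap.toMatrix'_mulVec _ _).symm
    rw [eval_sum_matrix, hA, ← Matrix.mulVec_mulVec, ← Matrix.mulVec_mulVec,
      Matrix.dotProduct_mulVec u, Matrix.vecMul_transpose]
  refine ⟨(N 3 3,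
    .C (N 0 3 + N 3 0) * .X ^ 2 + .C (N 1 3 + N 3 1) * .X + .C (N 2 3 + N 3 2),
    .C (N 0 0) * .X ^ 4 + .C (N 0 1 + N 1 0) * .X ^ 3 + .C (N 0 2 + N 2 0 + N 1 1) * .X ^ 2
      + .C (N 1 2 + N 2 1) * .X + .C (N 2 2)), ?_, ?_, ?_, fun s w => ?_⟩
  · dsimp only
    compute_degree
  · dsimp only
    compute_degree
  · rw [hN]
    simp [dotProduct, Matrix.mulVec, Fin.sum_univ_four]
  · rw [hN]
    simp [dotProduct, Matrix.mulVec, Fin.sum_univ_four]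
    ring

theorem vanishesAt_mk_iff {n : ℕ} {F : MvPolynomial (Fin (n + 1)) ℂ} (hF : F.IsHomogeneous 2)
    {v : Fin (n + 1) → ℂ} (hv : v ≠ 0) :
    VanishesAt F (Projectivization.mk ℂ v hv) ↔ eval v F = 0 := by
  refine ⟨fun h => h v hv rfl, fun h x hx hvx => ?_⟩
  obtain ⟨a, rfl⟩ := (Projectivization.mk_eq_mk_iff' ℂ _ _ hv hx).1 hvx
  rw [eval_smul_of_isHomogeneous_two hF] at h
  have ha : a ≠ 0 := by rintro rfl; simp at hv
  simpa [ha] using h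

/-- Coordinates in which a quadric cone is `u₀ u₂ = u₁²` and, among the given points on it, only
the vertex lies in the plane `u₂ = 0`. -/
theorem exists_cone_coordinates {W : MvPolynomial (Fin 4) ℂ} (hW : W.IsHomogeneous 2)
    (hirr : Irreducible W) {v : Fin 4 → ℂ} (hv : v ≠ 0)
    (hsing : ∀ i, eval v (pderiv i W) = 0) (S : Finset (Fin 4 → ℂ))
    (hS : ∀ x ∈ S, eval x W = 0) :
    ∃ L : (Fin 4 → ℂ) ≃ₗ[ℂ] (Fin 4 → ℂ), ∀ x ∈ S,
      (∃ t, x = L ![0, 0, 0, t]) ∨ ∃ a s w : ℂ, x = a • L ![s ^ 2, s, 1, w] := by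
  obtain ⟨L, hL⟩ := exists_cone_normal_form hW hirr hv hsing
  obtain ⟨c, hc⟩ := exists_coneShear_symm_ne_zero (S.image L.symm)
  refine ⟨(coneShear c).trans L, fun x hx => ?_⟩
  obtain ⟨u, rfl⟩ : ∃ u, x = L (coneShear c u) := ⟨(coneShear c).symm (L.symm x), by simp⟩
  have hcone : u 0 * u 2 = u 1 ^ 2 := by
    have h := hS _ hx
    rw [hL] at h
    simp only [coneShear, LinearEquiv.coe_mk, LinearMap.coe_mk, AddHom.coe_mk,
      Matrix.cons_val] at h
    linear_combination h
  simp only [LinearEquiv.trans_apply, ← map_smul, L.injective.eq_iff,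
    (coneShear c).injective.eq_iff]
  by_cases h2 : u 2 = 0
  · have h := hc _ (Finset.mem_image_of_mem _ hx)
    simp only [LinearEquiv.symm_apply_apply] at h
    obtain ⟨h0, h1, -⟩ := h h2
    simp only [coneShear, LinearEquiv.coe_mk, LinearMap.coe_mk, AddHom.coe_mk,
      Matrix.cons_val] at h0 h1
    refine .inl ⟨u 3, ?_⟩
    ext i
    fin_cases i
    · simpa using h0
    · simpa [h0] using h1
    · simpa using h2
    · simp
  · refine .inr ⟨u 2, u 1 / u 2, u 3 / u 2, ?_⟩
    ext i
    fin_cases i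
    · simp
      field_simp
      linear_combination hcone
    · simp
      field_simp
    · simp
    · simp
      field_simp

/-- The conic lemma: there is no finite set Φ ⊂ ℙ³ of at least 9 points such that the
linear system of quadrics through Φ has finite base locus and contains an irreducible
quadric cone through Φ. -/
theorem no_nine_points_on_quadric_cone (Φ : Finset (Pt 3)) (h9 : 9 ≤ Φ.card)
    (hbase : {p : Pt 3 | ∀ F : MvPolynomial (Fin 4) ℂ, F ≠ 0 → F.IsHomogeneous 2 →
      (∀ q ∈ Φ, VanishesAt F q) → VanishesAt F p}.Finite)
    (W : MvPolynomial (Fin 4) ℂ) (hW0 : W ≠ 0) (hWh : W.IsHomogeneous 2)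
    (hWirr : Irreducible W)
    (hWcone : ∃ p₀ : Pt 3, ∀ i : Fin 4, VanishesAt (MvPolynomial.pderiv i W) p₀)
    (hWΦ : ∀ q ∈ Φ, VanishesAt W q) :
    False := by
  classical
  obtain ⟨p₀, hp₀⟩ := hWcone
  obtain ⟨L, hL⟩ := exists_cone_coordinates hWh hWirr p₀.rep_nonzero
    (fun i => hp₀ i _ p₀.rep_nonzero p₀.mk_rep.symm) (Φ.image Projectivization.rep) (by
      simp only [Finset.mem_image, forall_exists_index, and_imp, forall_apply_eq_imp_iff₂]
      exact fun q hq => hWΦ q hq _ q.rep_nonzero q.mk_rep.symm)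
  have hvert : L ![0, 0, 0, 1] ≠ 0 := fun h => by
    simpa using congrFun (L.map_eq_zero_iff.1 h) 3
  have hpar : ∀ p : ℂ × ℂ, L ![p.1 ^ 2, p.1, 1, p.2] ≠ 0 := fun p h => by
    simpa using congrFun (L.map_eq_zero_iff.1 h) 2
  let vert : Pt 3 := .mk ℂ _ hvert
  let ψ : ℂ × ℂ → Pt 3 := fun p => .mk ℂ _ (hpar p)
  have hψ : Function.Injective ψ := by
    rintro ⟨s, w⟩ ⟨s', w'⟩ h
    obtain ⟨a, ha⟩ := (Projectivization.mk_eq_mk_iff' ℂ _ _ (hpar _) (hpar _)).1 h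
    rw [← map_smul, L.injective.eq_iff] at ha
    have h1 := congrFun ha 1
    have h2 := congrFun ha 2
    have h3 := congrFun ha 3
    simp at h1 h2 h3
    subst h2
    simp_all
  have hcover : Φ.erase vert ⊆ (Φ.preimage ψ hψ.injOn).image ψ := by
    intro q hq
    obtain ⟨hne, hq⟩ := Finset.mem_erase.1 hq
    rcases hL _ (Finset.mem_image_of_mem _ hq) with ⟨t, ht⟩ | ⟨a, s, w, hsw⟩
    · refine absurd ?_ hne
      rw [← q.mk_rep]
      refine (Projectivization.mk_eq_mk_iff' ℂ _ _ _ _).2 ⟨t, ?_⟩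
      rw [ht, ← map_smul]
      simp
    · have : ψ (s, w) = q := by
        rw [← q.mk_rep]
        exact ((Projectivization.mk_eq_mk_iff' ℂ _ _ _ _).2 ⟨a, hsw.symm⟩).symm
      exact Finset.mem_image.2 ⟨(s, w), by simpa [this] using hq, this⟩
  have hcard := (Finset.card_le_card hcover).trans Finset.card_image_le
  let V : Set (ℂ × Polynomial ℂ × Polynomial ℂ) := {f |
    f.2.1.natDegree ≤ 2 ∧ f.2.2.natDegree ≤ 4 ∧ ∃ F : MvPolynomial (Fin 4) ℂ,
      F.IsHomogeneous 2 ∧ (∀ q ∈ Φ, VanishesAt F q) ∧ eval (L ![0, 0, 0, 1]) F = f.1 ∧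
      ∀ s w, eval (L ![s ^ 2, s, 1, w]) F = f.1 * w ^ 2 + f.2.1.eval s * w + f.2.2.eval s}
  have hadd : ∀ f ∈ V, ∀ g ∈ V, f + g ∈ V := by
    rintro f ⟨hfb, hfc, F, hF, hFΦ, hFv, hFp⟩ g ⟨hgb, hgc, G, hG, hGΦ, hGv, hGp⟩
    refine ⟨Polynomial.natDegree_add_le_of_degree_le hfb hgb,
      Polynomial.natDegree_add_le_of_degree_le hfc hgc, F + G, hF.add hG, ?_, ?_, fun s w => ?_⟩
    · intro q hq v hv hqv
      rw [map_add, hFΦ q hq v hv hqv, hGΦ q hq v hv hqv, add_zero]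
    · rw [map_add, hFv, hGv, Prod.fst_add]
    · rw [map_add, hFp, hGp]
      simp only [Prod.fst_add, Prod.snd_add, Polynomial.eval_add]
      ring
  refine ((infinite_common_zeros V hadd (fun f hf => hf.1) (fun f hf => hf.2.1)
    (Φ.preimage ψ hψ.injOn) ?_ ?_ ?_).image hψ.injOn).mono ?_ hbase
  · have := Finset.pred_card_le_card_erase (s := Φ) (a := vert)
    omega
  · rintro ⟨f, ⟨-, -, F, -, hFΦ, hFv, -⟩, hf0⟩
    have hmem : vert ∉ Φ := fun hmem => hf0 (hFv ▸ hFΦ _ hmem _ hvert rfl)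
    rw [Finset.erase_eq_of_notMem hmem] at hcard
    omega
  · rintro f ⟨-, -, F, -, hFΦ, -, hFp⟩ p hp
    rw [← hFp]
    exact hFΦ _ (Finset.mem_preimage.1 hp) _ (hpar p) rfl
  · rintro _ ⟨p, hp, rfl⟩ F - hF hFΦ
    obtain ⟨f, hfb, hfc, hfv, hfp⟩ := exists_restriction_to_cone hF L
    rw [vanishesAt_mk_iff hF, hfp]
    exact hp f ⟨hfb, hfc, F, hF, hFΦ, hfv, hfp⟩
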